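/- (John–Nirenberg exponential integrability in Luxemburg norm form) Let $b \in \mathrm{BMO}(\mathbb{R}^n)$. Then there exist constants $c_0, C > 0$ depending only on $n$ such that for every cube $Q \subset \mathbb{R}^n$, $\frac{1}{|Q|} \int_Q \exp\left( \frac{|b(y) - b_Q|}{c_0 \|b\|_*} \right) dy \le C$; equivalently, $\|b - b_Q\|_{\exp L, Q} \le C' \|b\|_*$ for the Luxemburg norm with Young function $\mathcal{B}(t) = \exp(t) - 1$. -/

import Mathlib

open MeasureTheory Set

/-- The cube `Q(c, ℓ)` in `ℝⁿ` centered at `c` with side length `ℓ`. -/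
noncomputable def Cube (n : ℕ) (c : Fin n → ℝ) (ℓ : ℝ) : Set (Fin n → ℝ) :=
  {x | ∀ i, |x i - c i| ≤ ℓ / 2}

/-- The average `b_Q = |Q|⁻¹ ∫_Q b` over the cube `Q(c,ℓ)`. -/
noncomputable def avgQ (n : ℕ) (b : (Fin n → ℝ) → ℝ) (c : Fin n → ℝ) (ℓ : ℝ) : ℝ :=
  ((volume (Cube n c ℓ)).toReal)⁻¹ * ∫ x in Cube n c ℓ, b x

/-- The Luxemburg `A`-average of `f` over the cube `Q(c,ℓ)`:
`‖f‖_{A,Q} = inf {λ > 0 : |Q|⁻¹ ∫_Q A(|f|/λ) ≤ 1}`. -/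
noncomputable def luxNorm (n : ℕ) (A : ℝ → ℝ) (c : Fin n → ℝ) (ℓ : ℝ)
    (f : (Fin n → ℝ) → ℝ) : ℝ :=
  sInf {lam : ℝ | 0 < lam ∧
    ((volume (Cube n c ℓ)).toReal)⁻¹ * ∫ x in Cube n c ℓ, A (|f x| / lam) ≤ 1}

open Metric Filter Topology
open scoped ENNReal

namespace JN

lemma cube_eq (n : ℕ) (c : Fin n → ℝ) {ℓ : ℝ} (hℓ : 0 < ℓ) :
    Cube n c ℓ = closedBall c (ℓ / 2) := by
  ext x
  simp only [Cube, mem_setOf_eq, mem_closedBall]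
  rw [dist_pi_le_iff (by positivity)]
  simp [Real.dist_eq]

/-- mean of `b` on the ball of radius `s`. -/
noncomputable def mn (n : ℕ) (b : (Fin n → ℝ) → ℝ) (x : Fin n → ℝ) (s : ℝ) : ℝ :=
  ((2 * s) ^ n)⁻¹ * ∫ y in closedBall x s, b y

lemma vol (n : ℕ) (x : Fin n → ℝ) {s : ℝ} (hs : 0 < s) :
    volume (closedBall x s) = ENNReal.ofReal ((2 * s) ^ n) := by
  rw [Real.volume_pi_closedBall _ hs.le, Fintype.card_fin]

lemma volr (n : ℕ) (x : Fin n → ℝ) {s : ℝ} (hs : 0 < s) :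
    volume.real (closedBall x s) = (2 * s) ^ n := by
  rw [measureReal_def, vol n x hs, ENNReal.toReal_ofReal (by positivity)]

lemma locInt {n : ℕ} {b : (Fin n → ℝ) → ℝ} (hb : LocallyIntegrable b volume) (a : ℝ) :
    LocallyIntegrable (fun y => |b y - a|) volume := by
  have h : LocallyIntegrable (fun y => b y - a) volume := hb.sub (locallyIntegrable_const a)
  intro x
  obtain ⟨s, hs, hi⟩ := h x
  exact ⟨s, hs, hi.norm⟩

lemma intOn {n : ℕ} {f : (Fin n → ℝ) → ℝ} (hb : LocallyIntegrable f volume)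
    (x : Fin n → ℝ) (s : ℝ) : IntegrableOn f (closedBall x s) volume :=
  hb.integrableOn_isCompact (isCompact_closedBall x s)

lemma mono_ball {n : ℕ} {b : (Fin n → ℝ) → ℝ} (hb : LocallyIntegrable b volume) (a : ℝ)
    {x y : Fin n → ℝ} {s t : ℝ} (h : closedBall x s ⊆ closedBall y t) :
    ∫ z in closedBall x s, |b z - a| ≤ ∫ z in closedBall y t, |b z - a| :=
  setIntegral_mono_set (intOn (locInt hb a) y t) (Eventually.of_forall fun z => abs_nonneg _)
    (HasSubset.Subset.eventuallyLE h)

lemma mean_sub {n : ℕ} {b : (Fin n → ℝ) → ℝ} (hb : LocallyIntegrable b volume) (a : ℝ)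
    (x : Fin n → ℝ) {s : ℝ} (hs : 0 < s) :
    |mn n b x s - a| * (2 * s) ^ n ≤ ∫ z in closedBall x s, |b z - a| := by
  have hV : 0 < (2 * s) ^ n := by positivity
  have h1 : ∫ z in closedBall x s, (b z - a) = (mn n b x s - a) * (2 * s) ^ n := by
    rw [integral_sub (intOn hb x s) (integrableOn_const (by rw [vol n x hs]; simp)),
      setIntegral_const, volr n x hs, mn, smul_eq_mul]
    field_simp
  calc _ = |(mn n b x s - a) * (2 * s) ^ n| := by rw [abs_mul, abs_of_pos hV]
    _ = |∫ z in closedBall x s, (b z - a)| := by rw [h1]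
    _ ≤ _ := abs_integral_le_integral_abs

lemma osc_le {n : ℕ} {b : (Fin n → ℝ) → ℝ} (hb : LocallyIntegrable b volume) (a m : ℝ)
    (x : Fin n → ℝ) {s : ℝ} (hs : 0 < s) :
    ∫ z in closedBall x s, |b z - a| ≤
      (∫ z in closedBall x s, |b z - m|) + |m - a| * (2 * s) ^ n := by
  have hc : IntegrableOn (fun _ : Fin n → ℝ => |m - a|) (closedBall x s) volume :=
    integrableOn_const (by rw [vol n x hs]; simp)
  calc _ ≤ ∫ z in closedBall x s, (|b z - m| + |m - a|) :=
        integral_mono (intOn (locInt hb a) x s) ((intOn (locInt hb m) x s).add hc)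
          (fun z => abs_sub_le _ _ _)
    _ = _ := by
        rw [integral_add (intOn (locInt hb m) x s) hc, setIntegral_const, volr n x hs, smul_eq_mul]
        ring

/-- BMO condition on balls -/
def BMO (n : ℕ) (b : (Fin n → ℝ) → ℝ) (M : ℝ) : Prop :=
  ∀ (c : Fin n → ℝ) (r : ℝ), 0 < r →
    (∫ x in closedBall c r, |b x - mn n b c r|) ≤ M * (2 * r) ^ n

lemma double_bound {n : ℕ} {b : (Fin n → ℝ) → ℝ} (hb : LocallyIntegrable b volume) {M : ℝ}
    (h : BMO n b M) (x : Fin n → ℝ) {r : ℝ} (hr : 0 < r) :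
    ∫ z in closedBall x (2 * r), |b z - mn n b x r| ≤
      2 ^ n * (1 + 2 ^ n) * M * (2 * r) ^ n := by
  have hV : 0 < (2 * r) ^ n := by positivity
  have h2 := h x (2 * r) (by positivity)
  have h1 := mean_sub hb (mn n b x (2 * r)) x hr
  have h3 := mono_ball hb (mn n b x (2 * r))
    (closedBall_subset_closedBall (x := x) (by linarith : r ≤ 2 * r))
  have h4 := osc_le hb (mn n b x r) (mn n b x (2 * r)) x (by positivity : 0 < 2 * r)
  have e : (2 * (2 * r)) ^ n = 2 ^ n * (2 * r) ^ n := by rw [mul_pow]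
  rw [e] at h2 h4
  rw [abs_sub_comm] at h4
  have h5 : |mn n b x r - mn n b x (2 * r)| ≤ 2 ^ n * M := by
    refine le_of_mul_le_mul_right ?_ hV
    nlinarith
  have h6 : |mn n b x r - mn n b x (2 * r)| * (2 ^ n * (2 * r) ^ n)
    ≤ (2 ^ n * M) * (2 ^ n * (2 * r) ^ n) := by gcongr
  nlinarith

lemma five_bound {n : ℕ} {b : (Fin n → ℝ) → ℝ} (hb : LocallyIntegrable b volume) {M : ℝ}
    (hM : 0 < M) (h : BMO n b M) (x : Fin n → ℝ) {s a L : ℝ} (hs : 0 < s)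
    (hL : ∫ z in closedBall x (2 * s), |b z - a| ≤ L * (2 * (2 * s)) ^ n) :
    |mn n b x (5 * s) - a| ≤ L + 3 ^ n * M := by
  have hV : 0 < (2 * (2 * s)) ^ n := by positivity
  have h1 := mean_sub hb a x (by positivity : 0 < 2 * s)
  have h2 : |mn n b x (2 * s) - a| ≤ L := le_of_mul_le_mul_right (h1.trans hL) hV
  have h3 := mean_sub hb (mn n b x (5 * s)) x (by positivity : 0 < 2 * s)
  have h4 := mono_ball hb (mn n b x (5 * s))
    (closedBall_subset_closedBall (x := x) (by linarith : 2 * s ≤ 5 * s))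
  have h5 := h x (5 * s) (by positivity)
  have h6 : (2 * (5 * s)) ^ n ≤ 3 ^ n * (2 * (2 * s)) ^ n := by
    rw [← mul_pow]
    apply pow_le_pow_left₀ (by positivity)
    linarith
  have h7 : |mn n b x (2 * s) - mn n b x (5 * s)| ≤ 3 ^ n * M := by
    refine le_of_mul_le_mul_right ?_ hV
    nlinarith [mul_le_mul_of_nonneg_left h6 hM.le]
  rw [abs_sub_comm] at h7
  linarith [abs_sub_le (mn n b x (5 * s)) (mn n b x (2 * s)) a]

/-- Calderón–Zygmund-type covering. -/
lemma cz {n : ℕ} {b : (Fin n → ℝ) → ℝ} (hb : LocallyIntegrable b volume) {M : ℝ}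
    (hM : 0 < M) (h : BMO n b M) (x₀ : Fin n → ℝ) {r L : ℝ} (hr : 0 < r)
    (hL : 2 ^ n * (1 + 2 ^ n) * M ≤ L) :
    ∃ (u : Set (Fin n → ℝ)) (s : (Fin n → ℝ) → ℝ), u.Countable ∧ (∀ x ∈ u, 0 < s x) ∧
      (∀ x ∈ u, |mn n b x (5 * s x) - mn n b x₀ r| ≤ L + 3 ^ n * M) ∧
      (∑' x : u, volume (closedBall (x : Fin n → ℝ) (5 * s x))) ≤
        ENNReal.ofReal (5 ^ n * (2 ^ n * (1 + 2 ^ n)) * M / L) * volume (closedBall x₀ r) ∧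
      ∀ᵐ x, x ∈ closedBall x₀ r → x ∉ (⋃ y : u, closedBall (y : Fin n → ℝ) (5 * s y)) →
        |b x - mn n b x₀ r| ≤ L := by
  classical
  set a := mn n b x₀ r with ha
  have hLpos : 0 < L := lt_of_lt_of_le (by positivity) hL
  let P : (Fin n → ℝ) → ℕ → Prop := fun x k =>
    L * (2 * (r / 2 ^ k)) ^ n < ∫ z in closedBall x (r / 2 ^ k), |b z - a|
  let t : Set (Fin n → ℝ) := {x | x ∈ closedBall x₀ r ∧ ∃ k, P x k}
  let κ : (Fin n → ℝ) → ℕ := fun x => if hx : ∃ k, P x k then Nat.find hx else 0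
  let s : (Fin n → ℝ) → ℝ := fun x => r / 2 ^ κ x
  have hspos : ∀ x, 0 < s x := fun x => by positivity
  have hsr : ∀ x, s x ≤ r := fun x => div_le_self hr.le (one_le_pow₀ (by norm_num))
  have hP : ∀ x ∈ t, P x (κ x) := by
    intro x hx
    simp only [κ, dif_pos hx.2]
    exact Nat.find_spec hx.2
  have hsub2 : ∀ x ∈ closedBall x₀ r, ∀ q ≤ r, closedBall x q ⊆ closedBall x₀ (2 * r) := by
    intro x hx q hq
    apply closedBall_subset_closedBall'
    rw [mem_closedBall] at hx
    linarith
  have hdb := double_bound hb h x₀ hr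
  have hpar : ∀ x ∈ t, ∫ z in closedBall x (2 * s x), |b z - a| ≤ L * (2 * (2 * s x)) ^ n := by
    intro x hx
    have hk : κ x = Nat.find hx.2 := by simp only [κ, dif_pos hx.2]
    have hk0 : κ x ≠ 0 := by
      intro h0
      have h1 := hP x hx
      rw [h0] at h1
      simp only [P, pow_zero, div_one] at h1
      have h2 := mono_ball hb a (hsub2 x hx.1 r le_rfl)
      have h3 : 2 ^ n * (1 + 2 ^ n) * M * (2 * r) ^ n ≤ L * (2 * r) ^ n := by gcongr
      linarith
    obtain ⟨j, hj⟩ := Nat.exists_eq_succ_of_ne_zero hk0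
    have h2 : ¬ P x j := Nat.find_min hx.2 (by rw [← hk, hj]; exact Nat.lt_succ_self j)
    have h3 : 2 * s x = r / 2 ^ j := by
      simp only [s, hj, Nat.succ_eq_add_one, pow_succ]
      field_simp
    rw [h3]
    exact not_lt.mp h2
  obtain ⟨u, hut, hdis, hcov⟩ := Vitali.exists_disjoint_subfamily_covering_enlargement_closedBall
    t (fun x => x) s r (fun x _ => hsr x) 5 (by norm_num)
  have hucount : u.Countable := hdis.countable_of_nonempty_interior fun x _ =>
    (nonempty_ball.2 (hspos x)).mono ball_subset_interior_closedBall
  refine ⟨u, s, hucount, fun x _ => hspos x,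
    fun x hx => five_bound hb hM h x (hspos x) (hpar x (hut hx)), ?_, ?_⟩
  · -- sum
    have hone : ∀ x : u, volume (closedBall (x : Fin n → ℝ) (5 * s x)) ≤
        ENNReal.ofReal (5 ^ n / L) *
          ∫⁻ z in closedBall (x : Fin n → ℝ) (s x), ENNReal.ofReal |b z - a| := by
      intro x
      have h1 := hP x (hut x.2)
      rw [← ofReal_integral_eq_lintegral_ofReal (intOn (locInt hb a) _ _)
        (Eventually.of_forall fun z => abs_nonneg _), ← ENNReal.ofReal_mul (by positivity),
        vol n _ (by have := hspos x; positivity)]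
      apply ENNReal.ofReal_le_ofReal
      have h2 : L * (2 * s x) ^ n < ∫ z in closedBall (x : Fin n → ℝ) (s x), |b z - a| := h1
      rw [div_mul_eq_mul_div, le_div_iff₀ hLpos]
      have : (2 * (5 * s x)) ^ n = 5 ^ n * (2 * s x) ^ n := by rw [← mul_pow]; ring
      rw [this]
      nlinarith [pow_pos (by norm_num : (0:ℝ) < 5) n]
    calc _ ≤ ∑' x : u, ENNReal.ofReal (5 ^ n / L) *
          ∫⁻ z in closedBall (x : Fin n → ℝ) (s x), ENNReal.ofReal |b z - a| :=
          ENNReal.tsum_le_tsum hone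
      _ = ENNReal.ofReal (5 ^ n / L) *
          ∫⁻ z in ⋃ x ∈ u, closedBall (x : Fin n → ℝ) (s x), ENNReal.ofReal |b z - a| := by
          rw [ENNReal.tsum_mul_left, lintegral_biUnion hucount
            (fun _ _ => measurableSet_closedBall) hdis]
      _ ≤ ENNReal.ofReal (5 ^ n / L) *
          ∫⁻ z in closedBall x₀ (2 * r), ENNReal.ofReal |b z - a| := by
          gcongr
          exact iUnion₂_subset fun x hx => hsub2 x (hut hx).1 _ (hsr x)
      _ ≤ _ := by
          rw [← ofReal_integral_eq_lintegral_ofReal (intOn (locInt hb a) _ _)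
            (Eventually.of_forall fun z => abs_nonneg _), ← ENNReal.ofReal_mul (by positivity),
            vol n _ hr, ← ENNReal.ofReal_mul (by positivity)]
          apply ENNReal.ofReal_le_ofReal
          calc _ ≤ 5 ^ n / L * (2 ^ n * (1 + 2 ^ n) * M * (2 * r) ^ n) := by gcongr
            _ = _ := by ring
  · filter_upwards [IsUnifLocDoublingMeasure.ae_tendsto_average volume (locInt hb a) 1]
      with x hx hxB hxu
    have hnt : x ∉ t := by
      intro hxt
      obtain ⟨y, hy, hsub⟩ := hcov x hxt
      exact hxu (mem_iUnion.2 ⟨⟨y, hy⟩, hsub (mem_closedBall_self (hspos x).le)⟩)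
    have hlim : Tendsto (fun k : ℕ => r / 2 ^ k) atTop (𝓝[>] 0) := by
      rw [tendsto_nhdsWithin_iff]
      refine ⟨?_, Eventually.of_forall fun k => by simp only [mem_Ioi]; positivity⟩
      have := (tendsto_pow_atTop_nhds_zero_of_lt_one (by norm_num : (0:ℝ) ≤ 1/2)
        (by norm_num)).const_mul r
      simpa [div_eq_mul_inv] using this
    have h1 := hx (fun _ => x) (fun k : ℕ => r / 2 ^ k) hlim
      (Eventually.of_forall fun k => mem_closedBall_self (by positivity))
    refine le_of_tendsto' h1 fun k => ?_
    have hpos : 0 < r / 2 ^ k := by positivity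
    have h2 : ¬ P x k := fun hk => hnt ⟨hxB, k, hk⟩
    rw [setAverage_eq, volr n x hpos, smul_eq_mul, inv_mul_le_iff₀ (by positivity), mul_comm]
    exact not_lt.mp h2

lemma step {n : ℕ} {b : (Fin n → ℝ) → ℝ} (hb : LocallyIntegrable b volume) {M : ℝ}
    (hM : 0 < M) (h : BMO n b M) {N A L : ℝ} (hA : 0 < A)
    (hL : 2 ^ n * (1 + 2 ^ n) * M ≤ L) (S : ℝ≥0∞)
    (hS : ∀ (x : Fin n → ℝ) (s : ℝ), 0 < s →
      ∫⁻ z in closedBall x s, ENNReal.ofReal (Real.exp (min |b z - mn n b x s| N / A)) ≤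
        S * volume (closedBall x s)) (x₀ : Fin n → ℝ) (r : ℝ) (hr : 0 < r) :
    ∫⁻ z in closedBall x₀ r, ENNReal.ofReal (Real.exp (min |b z - mn n b x₀ r| N / A)) ≤
      (ENNReal.ofReal (Real.exp (L / A)) + ENNReal.ofReal (Real.exp ((L + 3 ^ n * M) / A)) * S *
        ENNReal.ofReal (5 ^ n * (2 ^ n * (1 + 2 ^ n)) * M / L)) * volume (closedBall x₀ r) := by
  obtain ⟨u, s, hu, hs, hmean, hsum, hae⟩ := cz hb hM h x₀ hr hL
  have := hu.to_subtype
  set a := mn n b x₀ r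
  set D := L + 3 ^ n * M
  set F : (Fin n → ℝ) → ℝ≥0∞ := fun z => ENNReal.ofReal (Real.exp (min |b z - a| N / A))
  set U := ⋃ y : u, closedBall (y : Fin n → ℝ) (5 * s y) with hU
  have hUm : MeasurableSet U := MeasurableSet.iUnion fun _ => measurableSet_closedBall
  have h1 : ∫⁻ z in closedBall x₀ r \ U, F z ≤
      ENNReal.ofReal (Real.exp (L / A)) * volume (closedBall x₀ r) := by
    calc _ ≤ ∫⁻ z in closedBall x₀ r \ U, ENNReal.ofReal (Real.exp (L / A)) := by
          apply setLIntegral_mono_ae' (measurableSet_closedBall.diff hUm)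
          filter_upwards [hae] with z hz hzm
          have := hz hzm.1 hzm.2
          have h2 := (min_le_left |b z - a| N).trans this
          simp only [F]
          gcongr
      _ = ENNReal.ofReal (Real.exp (L / A)) * volume (closedBall x₀ r \ U) := by
          rw [setLIntegral_const]
      _ ≤ _ := by gcongr; exact diff_subset
  have h2 : ∀ y : u, ∫⁻ z in closedBall (y : Fin n → ℝ) (5 * s y), F z ≤
      ENNReal.ofReal (Real.exp (D / A)) * S * volume (closedBall (y : Fin n → ℝ) (5 * s y)) := by
    intro y
    have hy := hmean y y.2
    calc _ ≤ ∫⁻ z in closedBall (y : Fin n → ℝ) (5 * s y), ENNReal.ofReal (Real.exp (D / A)) *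
          ENNReal.ofReal (Real.exp (min |b z - mn n b y (5 * s y)| N / A)) := by
          apply lintegral_mono
          intro z
          simp only [F]
          rw [← ENNReal.ofReal_mul (by positivity), ← Real.exp_add, ← add_div]
          have hD : 0 ≤ D := (abs_nonneg _).trans hy
          have h3 : min |b z - a| N ≤ D + min |b z - mn n b y (5 * s y)| N := by
            rw [← min_add_add_left]
            apply min_le_min
            · linarith [abs_sub_le (b z) (mn n b y (5 * s y)) a]
            · linarith
          gcongr
      _ = ENNReal.ofReal (Real.exp (D / A)) * ∫⁻ z in closedBall (y : Fin n → ℝ) (5 * s y),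
          ENNReal.ofReal (Real.exp (min |b z - mn n b y (5 * s y)| N / A)) :=
          lintegral_const_mul' _ _ ENNReal.ofReal_ne_top
      _ ≤ _ := by
          rw [mul_assoc]
          gcongr
          exact hS _ _ (by have := hs y y.2; positivity)
  calc _ ≤ ∫⁻ z in (closedBall x₀ r \ U) ∪ U, F z := by
        apply lintegral_mono_set
        rw [diff_union_self]; exact subset_union_left
    _ ≤ (∫⁻ z in closedBall x₀ r \ U, F z) + ∫⁻ z in U, F z := lintegral_union_le _ _ _
    _ ≤ ENNReal.ofReal (Real.exp (L / A)) * volume (closedBall x₀ r) +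
        ∑' y : u, ENNReal.ofReal (Real.exp (D / A)) * S *
          volume (closedBall (y : Fin n → ℝ) (5 * s y)) :=
        add_le_add h1 ((lintegral_iUnion_le _ _).trans (ENNReal.tsum_le_tsum h2))
    _ ≤ _ := by
        rw [ENNReal.tsum_mul_left, add_mul]
        refine add_le_add le_rfl ?_
        rw [mul_assoc _ (ENNReal.ofReal (5 ^ n * _ * M / L))]
        exact mul_le_mul_right hsum _

/-- the constant -/
noncomputable def cc (n : ℕ) : ℝ := 5 * (8 * 5 ^ n * (2 ^ n * (1 + 2 ^ n)) + 3 ^ n)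

lemma cc_pos (n : ℕ) : 0 < cc n := by unfold cc; positivity

lemma exp_fifth {x : ℝ} (hx : x ≤ 1 / 5) : Real.exp x ≤ 5 / 4 := by
  have h := Real.one_sub_le_exp_neg x
  rw [Real.exp_neg] at h
  have h2 : (4 / 5 : ℝ) ≤ (Real.exp x)⁻¹ := by linarith
  have := inv_anti₀ (by norm_num) h2
  rw [inv_inv] at this
  norm_num at this
  exact this

lemma trunc {n : ℕ} {b : (Fin n → ℝ) → ℝ} (hb : LocallyIntegrable b volume) {M : ℝ}
    (hM : 0 < M) (h : BMO n b M) (N : ℝ) (x : Fin n → ℝ) (s : ℝ) (hs : 0 < s) :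
    ∫⁻ z in closedBall x s, ENNReal.ofReal (Real.exp (min |b z - mn n b x s| N / (cc n * M))) ≤
        2 * volume (closedBall x s) := by
  have hA : 0 < cc n * M := mul_pos (cc_pos n) hM
  set A := cc n * M with hAdef
  set L := 8 * 5 ^ n * (2 ^ n * (1 + 2 ^ n)) * M with hLdef
  have hLpos : 0 < L := by positivity
  have hL : 2 ^ n * (1 + 2 ^ n) * M ≤ L := by
    have h5 : (1:ℝ) ≤ 8 * 5 ^ n := by
      have : (1:ℝ) ≤ 5 ^ n := one_le_pow₀ (by norm_num)
      linarith
    have : 0 ≤ 2 ^ n * (1 + 2 ^ n) * M := by positivity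
    calc _ = 1 * (2 ^ n * (1 + 2 ^ n) * M) := by ring
      _ ≤ (8 * 5 ^ n) * (2 ^ n * (1 + 2 ^ n) * M) := by gcongr
      _ = L := by rw [hLdef]; ring
  have hDA : (L + 3 ^ n * M) / A ≤ 1 / 5 := by
    rw [div_le_iff₀ hA, hAdef, hLdef, cc]
    apply le_of_eq; ring
  have hLA : L / A ≤ 1 / 5 := by
    refine le_trans ?_ hDA
    gcongr
    have : 0 ≤ 3 ^ n * M := by positivity
    linarith
  have hratio : 5 ^ n * (2 ^ n * (1 + 2 ^ n)) * M / L = 1 / 8 := by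
    rw [hLdef]; field_simp
  let I : (Fin n → ℝ) → ℝ → ℝ≥0∞ := fun x s =>
    ∫⁻ z in closedBall x s, ENNReal.ofReal (Real.exp (min |b z - mn n b x s| N / A))
  let S : ℝ≥0∞ := sInf {T | ∀ (x : Fin n → ℝ) (s : ℝ), 0 < s → I x s ≤ T * volume (closedBall x s)}
  have hvol0 : ∀ (x : Fin n → ℝ) (s : ℝ), 0 < s → volume (closedBall x s) ≠ 0 := fun x s hs =>
    (measure_closedBall_pos volume x hs).ne'
  have hvolt : ∀ (x : Fin n → ℝ) (s : ℝ), volume (closedBall x s) ≠ ⊤ := fun x s =>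
    measure_closedBall_lt_top.ne
  have hSmem : ∀ (x : Fin n → ℝ) (s : ℝ), 0 < s → I x s ≤ S * volume (closedBall x s) := by
    intro x s hs
    rw [← ENNReal.div_le_iff (hvol0 x s hs) (hvolt x s)]
    refine le_sInf fun T hT => ?_
    rw [ENNReal.div_le_iff (hvol0 x s hs) (hvolt x s)]
    exact hT x s hs
  have hSfin : S ≤ ENNReal.ofReal (Real.exp (N / A)) := by
    refine sInf_le fun x s hs => ?_
    calc I x s ≤ ∫⁻ z in closedBall x s, ENNReal.ofReal (Real.exp (N / A)) := by
          apply lintegral_mono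
          intro z
          have := min_le_right |b z - mn n b x s| N
          dsimp only
          gcongr
      _ = _ := by rw [setLIntegral_const]
  have hStop : S ≠ ⊤ := ne_top_of_le_ne_top ENNReal.ofReal_ne_top hSfin
  have hSle : S ≤ ENNReal.ofReal (5 / 4) + ENNReal.ofReal (5 / 4) * S * ENNReal.ofReal (1 / 8) := by
    refine sInf_le fun x s hs => ?_
    refine (step hb hM h hA hL S hSmem x s hs).trans ?_
    rw [hratio]
    gcongr
    · exact exp_fifth hLA
    · exact exp_fifth hDA
  have hS2 : S ≤ 2 := by
    lift S to NNReal using hStop with S'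
    have h1 : (S' : ℝ≥0∞) = ENNReal.ofReal (S' : ℝ) := by simp
    rw [h1, ← ENNReal.ofReal_mul (by norm_num), ← ENNReal.ofReal_mul (by positivity),
      ← ENNReal.ofReal_add (by norm_num) (by positivity),
      ENNReal.ofReal_le_ofReal_iff (by positivity)] at hSle
    have : (S' : ℝ) ≤ 2 := by linarith
    exact_mod_cast this
  calc _ ≤ S * volume (closedBall x s) := hSmem x s hs
    _ ≤ _ := by gcongr

lemma full {n : ℕ} {b : (Fin n → ℝ) → ℝ} (hb : LocallyIntegrable b volume) {M : ℝ}
    (hM : 0 < M) (h : BMO n b M) (x : Fin n → ℝ) (s : ℝ) (hs : 0 < s) :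
    ∫⁻ z in closedBall x s, ENNReal.ofReal (Real.exp (|b z - mn n b x s| / (cc n * M))) ≤
        2 * volume (closedBall x s) := by
  have hA : 0 < cc n * M := mul_pos (cc_pos n) hM
  have hm : AEMeasurable b (volume.restrict (closedBall x s)) :=
    hb.aestronglyMeasurable.aemeasurable.restrict
  have hlim := lintegral_tendsto_of_tendsto_of_monotone (μ := volume.restrict (closedBall x s))
    (f := fun (N : ℕ) z =>
      ENNReal.ofReal (Real.exp (min |b z - mn n b x s| N / (cc n * M))))
    (F := fun z => ENNReal.ofReal (Real.exp (|b z - mn n b x s| / (cc n * M))))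
    (fun N => by
      have h1 : AEMeasurable (fun z => |b z - mn n b x s|) (volume.restrict (closedBall x s)) :=
        (hm.sub_const _).abs
      exact (((h1.min aemeasurable_const).div_const _).exp).ennreal_ofReal)
    (Eventually.of_forall fun z i j hij => by
      dsimp only
      gcongr)
    (Eventually.of_forall fun z => by
      apply tendsto_const_nhds.congr'
      obtain ⟨k, hk⟩ := exists_nat_ge |b z - mn n b x s|
      filter_upwards [eventually_ge_atTop k] with j hj
      have : |b z - mn n b x s| ≤ (j : ℝ) := hk.trans (by exact_mod_cast hj)
      rw [min_eq_left this])
  exact le_of_tendsto' hlim fun N => trunc hb hM h N x s hs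

end JN

open JN

/-- John–Nirenberg, exponential integrability form. -/
theorem john_nirenberg_exponential (n : ℕ) (hn : 0 < n) :
    ∃ c₀ C C' : ℝ, 0 < c₀ ∧ 0 < C ∧ 0 < C' ∧
      ∀ b : (Fin n → ℝ) → ℝ, LocallyIntegrable b volume →
      ∀ M : ℝ, 0 < M →
      (∀ (c : Fin n → ℝ) (ℓ : ℝ), 0 < ℓ →
        (∫ x in Cube n c ℓ, |b x - avgQ n b c ℓ|) ≤ M * (volume (Cube n c ℓ)).toReal) →
      ∀ (c : Fin n → ℝ) (ℓ : ℝ), 0 < ℓ →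
        ((volume (Cube n c ℓ)).toReal)⁻¹ *
            ∫ x in Cube n c ℓ, Real.exp (|b x - avgQ n b c ℓ| / (c₀ * M)) ≤ C ∧
        luxNorm n (fun t => Real.exp t - 1) c ℓ (fun x => b x - avgQ n b c ℓ) ≤ C' * M := by
  refine ⟨cc n, 2, cc n, cc_pos n, by norm_num, cc_pos n, ?_⟩
  intro b hb M hM hbmo c ℓ hℓ
  have hv : ∀ (c : Fin n → ℝ) {ℓ : ℝ}, 0 < ℓ →
      (volume (closedBall c (ℓ / 2))).toReal = (2 * (ℓ / 2)) ^ n := fun c ℓ hℓ =>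
    volr n c (by positivity)
  have havg : ∀ (c : Fin n → ℝ) {ℓ : ℝ}, 0 < ℓ → avgQ n b c ℓ = mn n b c (ℓ / 2) := by
    intro c ℓ hℓ
    rw [avgQ, mn, cube_eq n c hℓ, hv c hℓ]
  have hB : BMO n b M := by
    intro x r hr
    have h1 := hbmo x (2 * r) (by positivity)
    rw [havg x (by positivity), cube_eq n x (by positivity), hv x (by positivity)] at h1
    have e : 2 * r / 2 = r := by ring
    rw [e] at h1
    exact h1
  have hr : 0 < ℓ / 2 := by positivity
  have hV : 0 < (2 * (ℓ / 2)) ^ n := by positivity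
  have hf := full hb hM hB c (ℓ / 2) hr
  set A := cc n * M
  have hA : 0 < A := mul_pos (cc_pos n) hM
  set m := mn n b c (ℓ / 2) with hmdef
  have hm : AEMeasurable (fun z => Real.exp (|b z - m| / A))
      (volume.restrict (closedBall c (ℓ / 2))) := by
    have hm : AEMeasurable b (volume.restrict (closedBall c (ℓ / 2))) :=
      hb.aestronglyMeasurable.aemeasurable.restrict
    exact ((hm.sub_const _).abs.div_const _).exp
  have hfin : (2 : ℝ≥0∞) * volume (closedBall c (ℓ / 2)) ≠ ⊤ :=
    ENNReal.mul_ne_top (by norm_num) measure_closedBall_lt_top.ne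
  have hnn : 0 ≤ᵐ[volume.restrict (closedBall c (ℓ / 2))] fun z => Real.exp (|b z - m| / A) :=
    Eventually.of_forall fun z => (Real.exp_pos _).le
  have hint : IntegrableOn (fun z => Real.exp (|b z - m| / A)) (closedBall c (ℓ / 2)) volume := by
    refine ⟨hm.aestronglyMeasurable, ?_⟩
    rw [hasFiniteIntegral_iff_ofReal hnn]
    exact hf.trans_lt hfin.lt_top
  have hle : ∫ z in closedBall c (ℓ / 2), Real.exp (|b z - m| / A) ≤ 2 * (2 * (ℓ / 2)) ^ n := by
    rw [integral_eq_lintegral_of_nonneg_ae hnn hm.aestronglyMeasurable]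
    refine (ENNReal.toReal_mono hfin hf).trans ?_
    rw [ENNReal.toReal_mul, hv c hℓ]
    simp
  constructor
  · rw [havg c hℓ, cube_eq n c hℓ, hv c hℓ, inv_mul_le_iff₀ hV, mul_comm _ (2 : ℝ)]
    exact hle
  · refine csInf_le ⟨0, fun x hx => hx.1.le⟩ ⟨hA, ?_⟩
    rw [havg c hℓ, cube_eq n c hℓ, hv c hℓ, inv_mul_le_iff₀ hV,
      integral_sub hint (integrableOn_const measure_closedBall_lt_top.ne), setIntegral_const,
      measureReal_def, hv c hℓ, smul_eq_mul]
    linarith
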